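/- arXiv:2202.02507 — 6 statements merged into one kernel-verified Lean document; each statement's English description precedes it below -/
import Mathlib

section
/- The function ψ : ℝ → ℝ defined by ψ(x) = k₂x for x ∈ (−∞, −1] ∪ [−1/2, ∞) and ψ(x) = min{−k₂ + k⁺(x + 1), −k₂/2 + k₁(x + 1/2)} for x ∈ (−1, −1/2) is continuous and strictly increasing on ℝ, and moreover the function x ↦ ψ(x) − k₁x is nondecreasing on ℝ. -/
open Real Filter Set

/-- x-coordinate of the intersection of the lines y = k*x and y = -k₂/2 + k₁(x+1/2). -/
noncomputable def xstar (k1 k2 ks : ℝ) : ℝ := (k1 - k2) / (2 * (ks - k1))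

/-- y-coordinate: y* = k* x*. -/
noncomputable def ystar (k1 k2 ks : ℝ) : ℝ := ks * xstar k1 k2 ks

/-- The slope k⁺ = (y* + k₂)/(x* + 1). -/
noncomputable def kplus (k1 k2 ks : ℝ) : ℝ :=
  (ystar k1 k2 ks + k2) / (xstar k1 k2 ks + 1)

/-- The function ψ: equal to k₂x outside (-1, -1/2), and the min of the two lines inside. -/
noncomputable def psi (k1 k2 ks : ℝ) (x : ℝ) : ℝ :=
  if x ∈ Set.Ioo (-1 : ℝ) (-(1 / 2) : ℝ) then
    min (-k2 + kplus k1 k2 ks * (x + 1)) (-k2 / 2 + k1 * (x + 1 / 2))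
  else k2 * x

/-- The rescaled functions ψ_j(x) = 2^(-j) ψ(2^j x). -/
noncomputable def psij (k1 k2 ks : ℝ) (j : ℕ) (x : ℝ) : ℝ :=
  (2 : ℝ) ^ (-(j : ℤ)) * psi k1 k2 ks ((2 : ℝ) ^ j * x)

/-- η(x) = sup_{j ≥ 1} ψ_j(x). -/
noncomputable def eta (k1 k2 ks : ℝ) (x : ℝ) : ℝ :=
  ⨆ j : {j : ℕ // 1 ≤ j}, psij k1 k2 ks j x

/-- h(x) = η(x - d). -/
noncomputable def hfun (k1 k2 ks d : ℝ) (x : ℝ) : ℝ := eta k1 k2 ks (x - d)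

/-- f(x) = k₀ (x - d). -/
noncomputable def ffun (k0 d : ℝ) (x : ℝ) : ℝ := k0 * (x - d)

/-- g(x) = f(-x) - h(-x). -/
noncomputable def gfun (k0 k1 k2 ks d : ℝ) (x : ℝ) : ℝ :=
  ffun k0 d (-x) - hfun k1 k2 ks d (-x)

theorem lt_kplus {k1 k2 ks : ℝ}
    (hks1 : (k1 + k2) / 2 < ks) (hks2 : ks < k2) : k2 < kplus k1 k2 ks := by
  have hden : 0 < 2 * (ks - k1) := by linarith
  have hneg : xstar k1 k2 ks < 0 := div_neg_of_neg_of_pos (by linarith) hden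
  have hgt : -1 < xstar k1 k2 ks := by
    rw [xstar, lt_div_iff₀ hden]
    linarith
  rw [kplus, ystar, lt_div_iff₀ (by linarith)]
  nlinarith

theorem psi_eq_max_min {k1 k2 ks : ℝ} (hk12 : k1 < k2) (hkp : k2 < kplus k1 k2 ks) (x : ℝ) :
    psi k1 k2 ks x =
      max (k2 * x) (min (-k2 + kplus k1 k2 ks * (x + 1)) (-k2 / 2 + k1 * (x + 1 / 2))) := by
  unfold psi
  split_ifs with h
  · obtain ⟨h1, h2⟩ := h
    exact (max_eq_right (le_min (by nlinarith) (by nlinarith))).symm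
  · refine (max_eq_left ?_).symm
    rcases le_or_gt x (-1) with h1 | h1
    · exact (min_le_left _ _).trans (by nlinarith)
    · have h2 : -(1 / 2) ≤ x := not_lt.mp fun h2 => h ⟨h1, h2⟩
      exact (min_le_right _ _).trans (by nlinarith)

/-- ψ is continuous and strictly increasing, and x ↦ ψ(x) − k₁x is nondecreasing. -/
theorem stmt_1 (k1 k2 ks : ℝ) (hk1 : 0 < k1) (hk12 : k1 < k2)
    (hks1 : (k1 + k2) / 2 < ks) (hks2 : ks < k2) :
    Continuous (psi k1 k2 ks) ∧ StrictMono (psi k1 k2 ks) ∧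
      Monotone (fun x => psi k1 k2 ks x - k1 * x) := by
  have hkp := lt_kplus hks1 hks2
  have hpsi : psi k1 k2 ks = fun x =>
      max (k2 * x) (min (-k2 + kplus k1 k2 ks * (x + 1)) (-k2 / 2 + k1 * (x + 1 / 2))) :=
    funext (psi_eq_max_min hk12 hkp)
  have hmono : Monotone (fun x => psi k1 k2 ks x - k1 * x) := by
    intro x y hxy
    simp only [hpsi, ← max_sub_sub_right, ← min_sub_sub_right]
    exact max_le_max (by nlinarith) (min_le_min (by nlinarith) (by linarith))
  refine ⟨?_, fun x y hxy => ?_, hmono⟩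
  · rw [hpsi]
    fun_prop
  · have hle : psi k1 k2 ks x - k1 * x ≤ psi k1 k2 ks y - k1 * y := hmono hxy.le
    have hlt : k1 * x < k1 * y := mul_lt_mul_of_pos_left hxy hk1
    linarith
end

section
/- The function η(x) = sup_{j ≥ 1} ψ_j(x) satisfies: η(x) = k₂x for all x ∈ (−∞, −1/2] ∪ [0, ∞), and for every integer j ≥ 1 and every x ∈ (−2^{−j}, −2^{−j−1}) one has η(x) = ψ_j(x) > k₂x. -/
open Real Filter Set

theorem lt_psi {k1 k2 ks x : ℝ} (hk12 : k1 < k2) (hks1 : (k1 + k2) / 2 < ks) (hks2 : ks < k2)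
    (hx : x ∈ Set.Ioo (-1 : ℝ) (-(1 / 2) : ℝ)) : k2 * x < psi k1 k2 ks x := by
  have hk := lt_kplus hks1 hks2
  rw [psi, if_pos hx]
  obtain ⟨h1, h2⟩ := hx
  refine lt_min ?_ ?_ <;> nlinarith

theorem psij_eq_of_notMem (k1 k2 ks : ℝ) {x : ℝ} {j : ℕ}
    (hx : (2 : ℝ) ^ j * x ∉ Set.Ioo (-1 : ℝ) (-(1 / 2) : ℝ)) : psij k1 k2 ks j x = k2 * x := by
  rw [psij, psi, if_neg hx, zpow_neg, zpow_natCast]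
  field_simp

theorem lt_psij {k1 k2 ks x : ℝ} {j : ℕ} (hk12 : k1 < k2) (hks1 : (k1 + k2) / 2 < ks)
    (hks2 : ks < k2) (hx : (2 : ℝ) ^ j * x ∈ Set.Ioo (-1 : ℝ) (-(1 / 2) : ℝ)) :
    k2 * x < psij k1 k2 ks j x := by
  have h := lt_psi hk12 hks1 hks2 hx
  rw [psij, zpow_neg, zpow_natCast, lt_inv_mul_iff₀ (by positivity)]
  linarith

/-- The dyadic intervals on which the functions `psij` exceed `k2 * x` are pairwise disjoint. -/
theorem two_pow_mul_notMem_of_ne {x : ℝ} {i j : ℕ} (hij : i ≠ j)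
    (hx : (2 : ℝ) ^ j * x ∈ Set.Ioo (-1 : ℝ) (-(1 / 2) : ℝ)) :
    (2 : ℝ) ^ i * x ∉ Set.Ioo (-1 : ℝ) (-(1 / 2) : ℝ) := by
  have key : ∀ {a b : ℕ}, a < b → (2 : ℝ) ^ a * x ∈ Set.Ioo (-1 : ℝ) (-(1 / 2) : ℝ) →
      (2 : ℝ) ^ b * x ∉ Set.Ioo (-1 : ℝ) (-(1 / 2) : ℝ) := by
    rintro a b hab ⟨-, ha⟩ ⟨hb, -⟩
    have hx0 : x < 0 := by
      by_contra! h
      have : 0 ≤ (2 : ℝ) ^ a * x := by positivity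
      linarith
    have hpow : (2 : ℝ) ^ (a + 1) ≤ 2 ^ b := pow_le_pow_right₀ one_le_two hab
    rw [pow_succ] at hpow
    nlinarith
  rcases hij.lt_or_gt with h | h
  · exact fun hi => key h hi hx
  · exact key h hx

/-- η(x) = k₂x on (−∞,−1/2] ∪ [0,∞), and η = ψ_j > k₂x on (−2^{−j}, −2^{−j−1}). -/
theorem stmt_4 (k1 k2 ks : ℝ) (hk1 : 0 < k1) (hk12 : k1 < k2)
    (hks1 : (k1 + k2) / 2 < ks) (hks2 : ks < k2) :
    (∀ x ∈ Set.Iic (-(1 / 2) : ℝ) ∪ Set.Ici (0 : ℝ), eta k1 k2 ks x = k2 * x) ∧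
    (∀ j : ℕ, 1 ≤ j →
      ∀ x ∈ Set.Ioo (-(2 : ℝ) ^ (-(j : ℤ))) (-(2 : ℝ) ^ (-(j : ℤ) - 1)),
        eta k1 k2 ks x = psij k1 k2 ks j x ∧ k2 * x < psij k1 k2 ks j x) := by
  constructor
  · intro x hx
    have hconst : ∀ j : {j : ℕ // 1 ≤ j}, psij k1 k2 ks j x = k2 * x := by
      rintro ⟨j, hj⟩
      apply psij_eq_of_notMem
      rintro ⟨h1, h2⟩
      rcases hx with hx | hx
      · have hpow : (2 : ℝ) ^ 1 ≤ 2 ^ j := pow_le_pow_right₀ one_le_two hj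
        have hx' : x ≤ -(1 / 2) := hx
        nlinarith
      · have hx' : 0 ≤ x := hx
        have : 0 ≤ (2 : ℝ) ^ j * x := by positivity
        linarith
    have : Nonempty {j : ℕ // 1 ≤ j} := ⟨⟨1, le_rfl⟩⟩
    simp only [eta, hconst, ciSup_const]
  · rintro j hj x ⟨h1, h2⟩
    have hmem : (2 : ℝ) ^ j * x ∈ Set.Ioo (-1 : ℝ) (-(1 / 2) : ℝ) := by
      have hpos : (0 : ℝ) < 2 ^ j := by positivity
      have hinv : (2 : ℝ) ^ j * (2 ^ j)⁻¹ = 1 := mul_inv_cancel₀ hpos.ne'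
      rw [zpow_neg, zpow_natCast] at h1
      rw [zpow_sub_one₀ two_ne_zero, zpow_neg, zpow_natCast] at h2
      constructor <;> nlinarith
    have hlt := lt_psij hk12 hks1 hks2 hmem
    have hle : ∀ i : {i : ℕ // 1 ≤ i}, psij k1 k2 ks i x ≤ psij k1 k2 ks j x := by
      rintro ⟨i, hi⟩
      rcases eq_or_ne i j with rfl | hij
      · exact le_rfl
      · rw [psij_eq_of_notMem k1 k2 ks (two_pow_mul_notMem_of_ne hij hmem)]
        exact hlt.le
    have : Nonempty {j : ℕ // 1 ≤ j} := ⟨⟨j, hj⟩⟩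
    exact ⟨le_antisymm (ciSup_le hle)
      (le_ciSup (f := fun i : {i : ℕ // 1 ≤ i} => psij k1 k2 ks i x)
        ⟨_, Set.forall_mem_range.2 hle⟩ ⟨j, hj⟩), hlt⟩
end

section
/- For every integer j ≥ 1, the function η satisfies η(2^{−j} x*) = 2^{−j} y* and η(−2^{−j}) = −k₂ 2^{−j}; that is, the points (2^{−j} x*, 2^{−j} y*) lie on both the graph y = η(x) and the line y = k* x, and the points (−2^{−j}, −k₂ 2^{−j}) lie on both the graph y = η(x) and the line y = k₂ x. -/
open Real Filter Set

theorem two_zpow_le_half_of_neg {n : ℤ} (hn : n < 0) : (2 : ℝ) ^ n ≤ 1 / 2 := by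
  have h := zpow_le_zpow_right₀ (one_le_two : (1 : ℝ) ≤ 2) (show n ≤ -1 by omega)
  norm_num at h ⊢
  exact h

theorem two_le_two_zpow_of_pos {n : ℤ} (hn : 0 < n) : (2 : ℝ) ≤ (2 : ℝ) ^ n := by
  have h := zpow_le_zpow_right₀ (one_le_two : (1 : ℝ) ≤ 2) (show 1 ≤ n by omega)
  simpa using h

theorem two_pow_mul_two_zpow_neg_mul (i j : ℕ) (t : ℝ) :
    (2 : ℝ) ^ i * ((2 : ℝ) ^ (-(j : ℤ)) * t) = (2 : ℝ) ^ ((i : ℤ) - j) * t := by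
  rw [← mul_assoc, ← zpow_natCast, ← zpow_add₀ two_ne_zero, ← sub_eq_add_neg]

theorem neg_two_zpow_notMem_Ioo (n : ℤ) :
    -(2 : ℝ) ^ n ∉ Set.Ioo (-1 : ℝ) (-(1 / 2) : ℝ) := by
  rintro ⟨h1, h2⟩
  rcases lt_or_ge n 0 with hn | hn
  · linarith [two_zpow_le_half_of_neg hn]
  · linarith [one_le_zpow₀ (one_le_two : (1 : ℝ) ≤ 2) hn]

theorem two_zpow_mul_notMem_Ioo {n : ℤ} (hn : n ≠ 0) {t : ℝ}
    (ht : t ∈ Set.Ioo (-1 : ℝ) (-(1 / 2) : ℝ)) :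
    (2 : ℝ) ^ n * t ∉ Set.Ioo (-1 : ℝ) (-(1 / 2) : ℝ) := by
  obtain ⟨ht1, ht2⟩ := ht
  rintro ⟨h1, h2⟩
  rcases hn.lt_or_gt with hn | hn
  · nlinarith [two_zpow_le_half_of_neg hn]
  · nlinarith [two_le_two_zpow_of_pos hn]

theorem psij_of_notMem (k1 k2 ks : ℝ) {i : ℕ} {x : ℝ}
    (h : (2 : ℝ) ^ i * x ∉ Set.Ioo (-1 : ℝ) (-(1 / 2) : ℝ)) :
    psij k1 k2 ks i x = k2 * x := by
  rw [psij, psi, if_neg h, zpow_neg, zpow_natCast]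
  field_simp

theorem psij_two_zpow_neg_mul (k1 k2 ks : ℝ) (j : ℕ) (t : ℝ) :
    psij k1 k2 ks j ((2 : ℝ) ^ (-(j : ℤ)) * t) = (2 : ℝ) ^ (-(j : ℤ)) * psi k1 k2 ks t := by
  rw [psij, two_pow_mul_two_zpow_neg_mul, sub_self, zpow_zero, one_mul]

theorem xstar_mem_Ioo {k1 k2 ks : ℝ}
    (hks1 : (k1 + k2) / 2 < ks) (hks2 : ks < k2) :
    xstar k1 k2 ks ∈ Set.Ioo (-1 : ℝ) (-(1 / 2) : ℝ) := by
  have h : 0 < 2 * (ks - k1) := by linarith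
  constructor
  · rw [xstar, lt_div_iff₀ h]
    linarith
  · rw [xstar, div_lt_iff₀ h]
    linarith

theorem psi_xstar {k1 k2 ks : ℝ}
    (hks1 : (k1 + k2) / 2 < ks) (hks2 : ks < k2) :
    psi k1 k2 ks (xstar k1 k2 ks) = ystar k1 k2 ks := by
  have hx := xstar_mem_Ioo hks1 hks2
  have h1 : xstar k1 k2 ks + 1 ≠ 0 := by linarith [hx.1]
  have hleft : -k2 + kplus k1 k2 ks * (xstar k1 k2 ks + 1) = ystar k1 k2 ks := by
    rw [kplus, div_mul_cancel₀ _ h1]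
    ring
  have hright : -k2 / 2 + k1 * (xstar k1 k2 ks + 1 / 2) = ystar k1 k2 ks := by
    have h2 : ks - k1 ≠ 0 := by linarith
    rw [ystar, xstar]
    field_simp
    ring
  rw [psi, if_pos hx, hleft, hright, min_self]

theorem eta_eq_of_psij_le {k1 k2 ks x y : ℝ} {j : ℕ} (hj : 1 ≤ j)
    (h : psij k1 k2 ks j x = y) (hle : ∀ i, psij k1 k2 ks i x ≤ y) :
    eta k1 k2 ks x = y := by
  refine IsLUB.ciSup_eq (IsGreatest.isLUB ⟨⟨⟨j, hj⟩, h⟩, ?_⟩)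
  rintro _ ⟨i, rfl⟩
  exact hle i

/-- the points (2^{−j}x*, 2^{−j}y*) lie on y = η(x) and on y = k*x, and
the points (−2^{−j}, −k₂2^{−j}) lie on y = η(x) and on y = k₂x, for every j ≥ 1. -/
theorem stmt_5 (k1 k2 ks : ℝ) (hk1 : 0 < k1) (hk12 : k1 < k2)
    (hks1 : (k1 + k2) / 2 < ks) (hks2 : ks < k2) :
    ∀ j : ℕ, 1 ≤ j →
      eta k1 k2 ks ((2 : ℝ) ^ (-(j : ℤ)) * xstar k1 k2 ks)
          = (2 : ℝ) ^ (-(j : ℤ)) * ystar k1 k2 ks ∧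
      (2 : ℝ) ^ (-(j : ℤ)) * ystar k1 k2 ks
          = ks * ((2 : ℝ) ^ (-(j : ℤ)) * xstar k1 k2 ks) ∧
      eta k1 k2 ks (-(2 : ℝ) ^ (-(j : ℤ))) = -(k2 * (2 : ℝ) ^ (-(j : ℤ))) ∧
      -(k2 * (2 : ℝ) ^ (-(j : ℤ))) = k2 * (-(2 : ℝ) ^ (-(j : ℤ))) := by
  intro j hj
  have hx := xstar_mem_Ioo hks1 hks2
  refine ⟨?_, ?_, ?_, by ring⟩
  · have hself : psij k1 k2 ks j ((2 : ℝ) ^ (-(j : ℤ)) * xstar k1 k2 ks)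
        = (2 : ℝ) ^ (-(j : ℤ)) * ystar k1 k2 ks := by
      rw [psij_two_zpow_neg_mul, psi_xstar hks1 hks2]
    refine eta_eq_of_psij_le hj hself fun i => ?_
    rcases eq_or_ne i j with rfl | hij
    · exact hself.le
    · rw [psij_of_notMem, mul_left_comm, ystar]
      · gcongr ?_ * ?_
        nlinarith [hx.2]
      · rw [two_pow_mul_two_zpow_neg_mul]
        exact two_zpow_mul_notMem_Ioo (by omega) hx
  · rw [ystar]
    ring
  · have hlinear : ∀ i, psij k1 k2 ks i (-(2 : ℝ) ^ (-(j : ℤ)))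
        = -(k2 * (2 : ℝ) ^ (-(j : ℤ))) := by
      intro i
      rw [psij_of_notMem, mul_neg]
      have h := two_pow_mul_two_zpow_neg_mul i j (-1)
      rw [mul_neg_one, mul_neg_one] at h
      rw [h]
      exact neg_two_zpow_notMem_Ioo _
    exact eta_eq_of_psij_le hj (hlinear j) fun i => (hlinear i).le
end

section
/- (Lemma 4) Let f, g : ℝ → ℝ be continuous nondecreasing functions and λ > 0. Then there exists a unique pair (u, v) ∈ ℝ² satisfying the system λu + f(u − v) = 0 and λv + g(v − u) = 0. -/
theorem existsUnique_mul_add_eq_zero {k : ℝ → ℝ} (hkc : Continuous k) (hk : Monotone k)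
    {c : ℝ} (hc : 0 < c) : ∃! w : ℝ, c * w + k w = 0 := by
  have hmono : StrictMono fun w => c * w + k w := fun a b hab =>
    add_lt_add_of_lt_of_le (mul_lt_mul_of_pos_left hab hc) (hk hab.le)
  have hR : 0 ≤ |k 0| / c := by positivity
  have hcR : c * (|k 0| / c) = |k 0| := by field_simp
  have hlo : c * -(|k 0| / c) + k (-(|k 0| / c)) ≤ 0 := by
    have := hk (neg_nonpos.mpr hR)
    linarith [le_abs_self (k 0)]
  have hhi : 0 ≤ c * (|k 0| / c) + k (|k 0| / c) := by
    have := hk hR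
    linarith [neg_abs_le (k 0)]
  obtain ⟨w, hw⟩ := mem_range_of_exists_le_of_exists_ge
    (f := fun w => c * w + k w) (by fun_prop) ⟨_, hlo⟩ ⟨_, hhi⟩
  exact ⟨w, hw, fun y hy => hmono.injective (hy.trans hw.symm)⟩

/-- Lemma 4: for continuous nondecreasing f, g and λ > 0, the system
λu + f(u − v) = 0, λv + g(v − u) = 0 has a unique solution. -/
theorem stmt_13 (f g : ℝ → ℝ) (hfc : Continuous f) (hf : Monotone f)
    (hgc : Continuous g) (hg : Monotone g) (lam : ℝ) (hlam : 0 < lam) :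
    ∃! p : ℝ × ℝ, lam * p.1 + f (p.1 - p.2) = 0 ∧ lam * p.2 + g (p.2 - p.1) = 0 := by
  have hk : Monotone fun w => f w - g (-w) := fun a b hab =>
    sub_le_sub (hf hab) (hg (neg_le_neg hab))
  obtain ⟨w, hw, huniq⟩ := existsUnique_mul_add_eq_zero (by fun_prop) hk hlam
  have hsub : -f w / lam - -g (-w) / lam = w := by
    field_simp
    linarith
  refine ⟨(-f w / lam, -g (-w) / lam), ⟨?_, ?_⟩, ?_⟩
  · simp only [hsub]
    field_simp
    ring
  · simp only [← neg_sub (-f w / lam), hsub]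
    field_simp
    ring
  · rintro ⟨u, v⟩ ⟨hu, hv⟩
    dsimp only at hu hv
    rw [← neg_sub u v] at hv
    have huv : u - v = w := huniq _ (by dsimp only; linarith)
    rw [huv] at hu hv
    ext
    · rw [eq_div_iff hlam.ne']
      linarith
    · rw [eq_div_iff hlam.ne']
      linarith
end

section
/- (Theorem 2) For λ > 0 let (u_λ, v_λ) be the unique solution of the system λu + f(u − v) = 0, λv + g(v − u) = 0, and let μ_j = k₂ 2^{−j}/(d − 2^{−j}) and ν_j = 2^{−j}|y*|/(d − 2^{−j}|x*|) for integers j ≥ 1. Then lim_{j→∞} u_{μ_j} = k₀d/k₂ and lim_{j→∞} u_{ν_j} = k₀d/k*. In particular, liminf_{λ→0+} u_λ ≤ k₀d/k₂ < k₀d/k* ≤ limsup_{λ→0+} u_λ, so the family {(u_λ, v_λ)}_{λ>0} does not converge as λ → 0+. -/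
open Real Filter Set

theorem kplus_nonneg {k1 k2 ks : ℝ} (hk1 : 0 < k1) (hk12 : k1 < k2)
    (hks1 : (k1 + k2) / 2 < ks) (hks2 : ks < k2) : 0 ≤ kplus k1 k2 ks := by
  obtain ⟨h1, h2⟩ := xstar_mem_Ioo hks1 hks2
  refine div_nonneg ?_ (by linarith)
  rw [ystar]
  nlinarith

theorem psi_monotone {k1 k2 ks : ℝ} (hk1 : 0 < k1) (hk12 : k1 < k2)
    (hks1 : (k1 + k2) / 2 < ks) (hks2 : ks < k2) : Monotone (psi k1 k2 ks) := by
  intro x y hxy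
  have hk := kplus_nonneg hk1 hk12 hks1 hks2
  unfold psi
  split_ifs with hx hy hy
  · gcongr
  · have hy' : -(1 / 2) ≤ y := by
      by_contra! h
      exact hy ⟨hx.1.trans_le hxy, h⟩
    refine (min_le_right _ _).trans ?_
    have := hx.2
    nlinarith
  · have hx' : x ≤ -1 := by
      by_contra! h
      exact hx ⟨h, hxy.trans_lt hy.2⟩
    have := hy.1
    refine le_min ?_ ?_
    · nlinarith
    · nlinarith
  · nlinarith

theorem psi_le_of_nonpos {k1 k2 ks x : ℝ} (hk12 : k1 < k2) (hx : x ≤ 0) :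
    psi k1 k2 ks x ≤ k1 * x := by
  unfold psi
  split_ifs with h
  · exact (min_le_right _ _).trans (by linarith)
  · nlinarith

theorem psi_le_max {k1 k2 ks x : ℝ} (hk1 : 0 < k1) (hk12 : k1 < k2) :
    psi k1 k2 ks x ≤ max (k2 * x) 0 := by
  rcases le_total x 0 with hx | hx
  · exact ((psi_le_of_nonpos hk12 hx).trans (by nlinarith)).trans (le_max_right _ _)
  · rw [psi, if_neg (fun h => by linarith [h.2])]
    exact le_max_left _ _

theorem bddAbove_range_psij {k1 k2 ks : ℝ} (hk1 : 0 < k1) (hk12 : k1 < k2) (x : ℝ) :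
    BddAbove (Set.range fun j : {j : ℕ // 1 ≤ j} => psij k1 k2 ks j x) := by
  refine ⟨max (k2 * x) 0, ?_⟩
  rintro _ ⟨j, rfl⟩
  have hp : (0 : ℝ) < 2 ^ (j : ℕ) := by positivity
  have h := psi_le_max (ks := ks) (x := 2 ^ (j : ℕ) * x) hk1 hk12
  simp only [psij, zpow_neg, zpow_natCast]
  rw [inv_mul_le_iff₀ hp, mul_max_of_nonneg _ _ hp.le]
  rwa [mul_zero, mul_left_comm]

theorem eta_monotone {k1 k2 ks : ℝ} (hk1 : 0 < k1) (hk12 : k1 < k2)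
    (hks1 : (k1 + k2) / 2 < ks) (hks2 : ks < k2) : Monotone (eta k1 k2 ks) := by
  intro x y hxy
  refine ciSup_mono (bddAbove_range_psij hk1 hk12 y) fun j => ?_
  unfold psij
  gcongr
  exact psi_monotone hk1 hk12 hks1 hks2 (by gcongr)

theorem eta_le_of_nonpos {k1 k2 ks x : ℝ} (hk12 : k1 < k2) (hx : x ≤ 0) :
    eta k1 k2 ks x ≤ k1 * x := by
  have : Nonempty {j : ℕ // 1 ≤ j} := ⟨⟨1, le_rfl⟩⟩
  refine ciSup_le fun j => ?_
  have hp : (0 : ℝ) < 2 ^ (j : ℕ) := by positivity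
  simp only [psij, zpow_neg, zpow_natCast]
  rw [inv_mul_le_iff₀ hp]
  refine (psi_le_of_nonpos hk12 (mul_nonpos_of_nonneg_of_nonpos hp.le hx)).trans_eq (by ring)

theorem eta_nonneg {k1 k2 ks x : ℝ} (hk1 : 0 < k1) (hk12 : k1 < k2) (hx : 0 ≤ x) :
    0 ≤ eta k1 k2 ks x := by
  refine le_trans ?_ (le_ciSup (bddAbove_range_psij hk1 hk12 x) ⟨1, le_rfl⟩)
  have h2 : 0 ≤ (2 : ℝ) ^ 1 * x := by positivity
  have hk2 : 0 < k2 := hk1.trans hk12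
  simp only [psij]
  rw [psi, if_neg (fun h => by linarith [h.2])]
  positivity

/-- On a fundamental dyadic interval, the supremum defining `eta` is attained by the index that
scales the point into `[-1, -1/2)`. -/
theorem eta_scale {k1 k2 ks x : ℝ} (hk1 : 0 < k1) (hk12 : k1 < k2)
    (hx1 : -1 ≤ x) (hx2 : x < -(1 / 2)) (hx : k2 * x ≤ psi k1 k2 ks x) {j : ℕ} (hj : 1 ≤ j) :
    eta k1 k2 ks ((2 : ℝ) ^ (-(j : ℤ)) * x) = (2 : ℝ) ^ (-(j : ℤ)) * psi k1 k2 ks x := by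
  have : Nonempty {j : ℕ // 1 ≤ j} := ⟨⟨1, le_rfl⟩⟩
  have hpj : (0 : ℝ) < 2 ^ j := by positivity
  have hself : psij k1 k2 ks j ((2 : ℝ) ^ (-(j : ℤ)) * x) =
      (2 : ℝ) ^ (-(j : ℤ)) * psi k1 k2 ks x := by
    rw [psij, zpow_neg, zpow_natCast, mul_inv_cancel_left₀ hpj.ne']
  refine le_antisymm (ciSup_le ?_) ?_
  · rintro ⟨i, hi⟩
    rcases eq_or_ne i j with rfl | hij
    · exact hself.le
    have hpi : (0 : ℝ) < 2 ^ i := by positivity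
    have hout : (2 : ℝ) ^ i * ((2 : ℝ) ^ (-(j : ℤ)) * x) ∉
        Set.Ioo (-1 : ℝ) (-(1 / 2) : ℝ) := by
      rw [zpow_neg, zpow_natCast, ← mul_assoc, ← div_eq_mul_inv]
      rcases lt_or_gt_of_ne hij with h | h
      · have hr : (2 : ℝ) ^ i / 2 ^ j ≤ 1 / 2 := by
          rw [div_le_div_iff₀ hpj two_pos, one_mul, ← pow_succ]
          exact pow_le_pow_right₀ one_le_two h
        have hr0 : 0 < (2 : ℝ) ^ i / 2 ^ j := by positivity
        intro hmem
        nlinarith [hmem.2]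
      · have hr : 2 ≤ (2 : ℝ) ^ i / 2 ^ j := by
          rw [le_div_iff₀ hpj, ← pow_succ']
          exact pow_le_pow_right₀ one_le_two h
        intro hmem
        nlinarith [hmem.1]
    have hval : psij k1 k2 ks i ((2 : ℝ) ^ (-(j : ℤ)) * x) = (2 : ℝ) ^ (-(j : ℤ)) * (k2 * x) := by
      rw [psij, psi, if_neg hout, zpow_neg (2 : ℝ) (i : ℤ), zpow_natCast]
      field_simp
    exact hval.trans_le (by gcongr)
  · rw [← hself]
    exact le_ciSup (bddAbove_range_psij hk1 hk12 _) ⟨j, hj⟩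

theorem eq_of_resolvent_eq {k1 k2 ks d l y z : ℝ} (hk1 : 0 < k1) (hk12 : k1 < k2)
    (hks1 : (k1 + k2) / 2 < ks) (hks2 : ks < k2) (hl : 0 < l)
    (hy : l * (d + y) + eta k1 k2 ks y = 0) (hz : l * (d + z) + eta k1 k2 ks z = 0) :
    y = z := by
  have hη := eta_monotone hk1 hk12 hks1 hks2
  rcases lt_trichotomy y z with h | h | h
  · nlinarith [hη h.le]
  · exact h
  · nlinarith [hη h.le]

theorem tendsto_two_zpow_neg :
    Tendsto (fun j : ℕ => (2 : ℝ) ^ (-(j : ℤ))) atTop (nhds 0) := by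
  simpa [zpow_neg, Function.comp_def] using
    tendsto_inv_atTop_zero.comp (tendsto_pow_atTop_atTop_of_one_lt (one_lt_two (α := ℝ)))

theorem two_zpow_neg_le_half {j : ℕ} (hj : 1 ≤ j) : (2 : ℝ) ^ (-(j : ℤ)) ≤ 1 / 2 := by
  have h : (2 : ℝ) ^ (-(j : ℤ)) ≤ 2 ^ (-1 : ℤ) := zpow_le_zpow_right₀ one_le_two (by omega)
  simpa using h

theorem solution_sub_eq {k1 k2 ks d k0 l a b : ℝ}
    (h1 : l * a + ffun k0 d (a - b) = 0) (h2 : l * b + gfun k0 k1 k2 ks d (b - a) = 0) :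
    l * (d + (a - b - d)) + eta k1 k2 ks (a - b - d) = 0 := by
  simp only [gfun, hfun, ffun, neg_sub] at h1 h2
  linarith

theorem solution_mem_Icc {k1 k2 ks d k0 l a b : ℝ} (hk1 : 0 < k1) (hk12 : k1 < k2)
    (hd : 0 < d) (hk0 : 0 < k0) (hl : 0 < l)
    (h1 : l * a + ffun k0 d (a - b) = 0) (h2 : l * b + gfun k0 k1 k2 ks d (b - a) = 0) :
    a ∈ Set.Icc 0 (k0 * d / k1) := by
  have hz := solution_sub_eq h1 h2
  simp only [ffun] at h1
  set z := a - b - d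
  have hz0 : z ≤ 0 := by
    by_contra! h
    have := eta_nonneg (ks := ks) hk1 hk12 h.le
    nlinarith [mul_pos hl (add_pos hd h)]
  have hη := eta_le_of_nonpos (ks := ks) hk12 hz0
  have hza : l * a = k0 * -z := by linarith
  constructor
  · refine le_of_mul_le_mul_left ?_ hl
    rw [hza, mul_zero]
    exact mul_nonneg hk0.le (by linarith)
  · rw [le_div_iff₀ hk1]
    refine le_of_mul_le_mul_left ?_ hl
    have hb : k1 * -z ≤ l * d := by nlinarith
    calc l * (a * k1) = k0 * (k1 * -z) := by linear_combination k1 * hza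
      _ ≤ k0 * (l * d) := by gcongr
      _ = l * (k0 * d) := by ring

/-- Along the parameters for which the resolvent equation is solved by `2 ^ (-j) * x`, the
parameter tends to `0` from the right and the first component tends to `k0 * d * x / psi x`. -/
theorem tendsto_along_dyadic {k1 k2 ks d k0 x : ℝ} (hk1 : 0 < k1) (hk12 : k1 < k2)
    (hks1 : (k1 + k2) / 2 < ks) (hks2 : ks < k2) (hd : 1 ≤ d) {u v : ℝ → ℝ}
    (huv : ∀ l : ℝ, 0 < l →
      l * u l + ffun k0 d (u l - v l) = 0 ∧
      l * v l + gfun k0 k1 k2 ks d (v l - u l) = 0)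
    (hx1 : -1 ≤ x) (hx2 : x < -(1 / 2)) (hx : k2 * x ≤ psi k1 k2 ks x) {m : ℕ → ℝ}
    (hm : ∀ j : ℕ, m j = (2 : ℝ) ^ (-(j : ℤ)) * -psi k1 k2 ks x /
      (d + (2 : ℝ) ^ (-(j : ℤ)) * x)) :
    Tendsto m atTop (nhdsWithin 0 (Set.Ioi 0)) ∧
    Tendsto (fun j => u (m j)) atTop (nhds (k0 * d * x / psi k1 k2 ks x)) := by
  have hp : psi k1 k2 ks x < 0 :=
    (psi_le_of_nonpos hk12 (by linarith)).trans_lt (by nlinarith)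
  have hden : ∀ j : ℕ, 1 ≤ j → 0 < d + (2 : ℝ) ^ (-(j : ℤ)) * x := fun j hj => by
    have h0 : (0 : ℝ) < (2 : ℝ) ^ (-(j : ℤ)) := by positivity
    nlinarith [two_zpow_neg_le_half hj]
  have hpos : ∀ j : ℕ, 1 ≤ j → 0 < m j := fun j hj => by
    rw [hm]
    exact div_pos (mul_pos (by positivity) (by linarith)) (hden j hj)
  have hlim : Tendsto (fun j : ℕ => d + (2 : ℝ) ^ (-(j : ℤ)) * x) atTop (nhds d) := by
    simpa using (tendsto_two_zpow_neg.mul_const x).const_add d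
  constructor
  · refine tendsto_nhdsWithin_iff.2 ⟨?_, (eventually_ge_atTop 1).mono hpos⟩
    have h := (tendsto_two_zpow_neg.mul_const (-psi k1 k2 ks x)).div hlim (by linarith)
    rw [zero_mul, zero_div] at h
    exact h.congr fun j => (hm j).symm
  · have h : Tendsto (fun j : ℕ => k0 * (d + (2 : ℝ) ^ (-(j : ℤ)) * x) * x / psi k1 k2 ks x)
        atTop (nhds (k0 * d * x / psi k1 k2 ks x)) :=
      ((hlim.const_mul k0).mul_const x).div_const _
    refine h.congr' ((eventually_ge_atTop 1).mono fun j hj => ?_)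
    obtain ⟨h1, h2⟩ := huv (m j) (hpos j hj)
    have hm' : m j * (d + (2 : ℝ) ^ (-(j : ℤ)) * x) = (2 : ℝ) ^ (-(j : ℤ)) * -psi k1 k2 ks x := by
      rw [hm, div_mul_cancel₀ _ (hden j hj).ne']
    have hz : u (m j) - v (m j) - d = (2 : ℝ) ^ (-(j : ℤ)) * x := by
      refine eq_of_resolvent_eq hk1 hk12 hks1 hks2 (hpos j hj) (solution_sub_eq h1 h2) ?_
      rw [eta_scale hk1 hk12 hx1 hx2 hx hj, hm']
      ring
    rw [ffun, hz] at h1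
    rw [div_eq_iff hp.ne]
    refine mul_left_cancel₀ (hpos j hj).ne' ?_
    linear_combination (k0 * x) * hm' - psi k1 k2 ks x * h1

/-- Theorem 2: along μ_j the solutions u converge to k₀d/k₂, along ν_j
to k₀d/k*, hence liminf u ≤ k₀d/k₂ < k₀d/k* ≤ limsup u as λ → 0+, and the family
(u_λ, v_λ) does not converge as λ → 0+. -/
theorem stmt_15 (k1 k2 ks d k0 : ℝ) (hk1 : 0 < k1) (hk12 : k1 < k2)
    (hks1 : (k1 + k2) / 2 < ks) (hks2 : ks < k2) (hd : 1 ≤ d)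
    (hk00 : 0 < k0) (hk01 : k0 < k1)
    (u v : ℝ → ℝ)
    (huv : ∀ l : ℝ, 0 < l →
      l * u l + ffun k0 d (u l - v l) = 0 ∧
      l * v l + gfun k0 k1 k2 ks d (v l - u l) = 0)
    (μ ν : ℕ → ℝ)
    (hμ : ∀ j : ℕ, μ j = k2 * (2 : ℝ) ^ (-(j : ℤ)) / (d - (2 : ℝ) ^ (-(j : ℤ))))
    (hν : ∀ j : ℕ, ν j = (2 : ℝ) ^ (-(j : ℤ)) * |ystar k1 k2 ks| /
        (d - (2 : ℝ) ^ (-(j : ℤ)) * |xstar k1 k2 ks|)) :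
    Filter.Tendsto (fun j => u (μ j)) Filter.atTop (nhds (k0 * d / k2)) ∧
    Filter.Tendsto (fun j => u (ν j)) Filter.atTop (nhds (k0 * d / ks)) ∧
    Filter.liminf u (nhdsWithin 0 (Set.Ioi 0)) ≤ k0 * d / k2 ∧
    k0 * d / k2 < k0 * d / ks ∧
    k0 * d / ks ≤ Filter.limsup u (nhdsWithin 0 (Set.Ioi 0)) ∧
    ¬ ∃ p : ℝ × ℝ, Filter.Tendsto (fun l => (u l, v l)) (nhdsWithin 0 (Set.Ioi 0)) (nhds p) := by
  have hk2 : 0 < k2 := hk1.trans hk12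
  have hks : 0 < ks := by linarith
  have hd0 : 0 < d := by linarith
  have hxs := xstar_mem_Ioo hks1 hks2
  have hxs0 : xstar k1 k2 ks < 0 := by linarith [hxs.2]
  have hpx := psi_xstar hks1 hks2
  have hp1 : psi k1 k2 ks (-1) = -k2 := by
    rw [psi, if_neg (fun h => lt_irrefl _ h.1)]; ring
  have hys : ystar k1 k2 ks < 0 := mul_neg_of_pos_of_neg hks hxs0
  obtain ⟨hμ0, hμu⟩ := tendsto_along_dyadic (k0 := k0) (x := -1) (m := μ) hk1 hk12 hks1 hks2 hd
    huv le_rfl (by norm_num) (by rw [hp1]; linarith) fun j => by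
      rw [hμ, hp1]; congr 1 <;> ring
  obtain ⟨hν0, hνu⟩ := tendsto_along_dyadic (k0 := k0) (x := xstar k1 k2 ks) (m := ν)
    hk1 hk12 hks1 hks2 hd huv hxs.1.le hxs.2
    (by rw [hpx, ystar]; nlinarith) fun j => by
      rw [hν, hpx, abs_of_neg hys, abs_of_neg hxs0]; congr 1; ring
  have hμl : k0 * d * -1 / psi k1 k2 ks (-1) = k0 * d / k2 := by
    rw [hp1]; field_simp
  have hνl : k0 * d * xstar k1 k2 ks / psi k1 k2 ks (xstar k1 k2 ks) = k0 * d / ks := by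
    rw [hpx, ystar, mul_div_mul_right _ _ hxs0.ne]
  rw [hμl] at hμu
  rw [hνl] at hνu
  have hlt : k0 * d / k2 < k0 * d / ks := div_lt_div_of_pos_left (by positivity) hks hks2
  have hmem : ∀ᶠ l in nhdsWithin (0 : ℝ) (Set.Ioi 0), u l ∈ Set.Icc 0 (k0 * d / k1) :=
    eventually_mem_nhdsWithin.mono fun l hl =>
      solution_mem_Icc hk1 hk12 hd0 hk00 hl (huv l hl).1 (huv l hl).2
  have hbelow : IsBoundedUnder (· ≥ ·) (nhdsWithin (0 : ℝ) (Set.Ioi 0)) u :=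
    ⟨0, eventually_map.2 (hmem.mono fun _ h => h.1)⟩
  have habove : IsBoundedUnder (· ≤ ·) (nhdsWithin (0 : ℝ) (Set.Ioi 0)) u :=
    ⟨_, eventually_map.2 (hmem.mono fun _ h => h.2)⟩
  refine ⟨hμu, hνu, ?_, hlt, ?_, ?_⟩
  · rw [← hμu.liminf_eq]
    exact liminf_le_liminf_of_le (g := map μ atTop) hμ0 hbelow
      (tendsto_map'_iff.2 hμu).isCoboundedUnder_ge
  · rw [← hνu.limsup_eq]
    exact limsup_le_limsup_of_le (f := map ν atTop) hν0
      (tendsto_map'_iff.2 hνu).isCoboundedUnder_le habove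
  · rintro ⟨p, hp⟩
    have hu : Tendsto u (nhdsWithin 0 (Set.Ioi 0)) (nhds p.1) := hp.fst_nhds
    have e1 := tendsto_nhds_unique (hu.comp hμ0) hμu
    have e2 := tendsto_nhds_unique (hu.comp hν0) hνu
    exact hlt.ne (e1.symm.trans e2)
end

section
/- (Theorem 1) There exist two continuous strictly increasing functions f, g : ℝ → ℝ with the following properties: (a) for every λ > 0 there exists a unique solution (u_λ, v_λ) ∈ ℝ² of the system λu + f(u − v) = 0, λv + g(v − u) = 0; (b) the family {(u_λ, v_λ)}_{λ>0} of these solutions is bounded in ℝ²; (c) the family {(u_λ, v_λ)}_{λ>0} does not converge as λ → 0+ (i.e. there is no point (u⁰, v⁰) ∈ ℝ² such that (u_λ, v_λ) → (u⁰, v⁰) as λ → 0+). -/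
open Filter Topology

/-- A strictly increasing odd function whose slope at the origin oscillates. -/
noncomputable def oscillating (x : ℝ) : ℝ := x * (3 + Real.sin (Real.log x))

lemma oscillating_neg (x : ℝ) : oscillating (-x) = -oscillating x := by
  simp [oscillating]

lemma continuous_oscillating : Continuous oscillating := by
  rw [continuous_iff_continuousAt]
  intro x
  by_cases hx : x = 0
  · subst hx
    have h0 : oscillating 0 = 0 := by simp [oscillating]
    rw [ContinuousAt, h0]
    refine squeeze_zero_norm (a := fun x => 4 * |x|) (fun x => ?_) ?_
    · rw [oscillating, Real.norm_eq_abs, abs_mul, mul_comm]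
      gcongr
      rw [abs_le]
      constructor <;> linarith [Real.neg_one_le_sin (Real.log x), Real.sin_le_one (Real.log x)]
    · have h : Continuous fun x : ℝ => 4 * |x| := by fun_prop
      simpa using h.tendsto 0
  · unfold oscillating
    exact continuousAt_id.mul (continuousAt_const.add
      (Real.continuous_sin.continuousAt.comp (Real.continuousAt_log hx)))

lemma oscillating_pos {x : ℝ} (hx : 0 < x) : 0 < oscillating x :=
  mul_pos hx (by linarith [Real.neg_one_le_sin (Real.log x)])

lemma strictMono_oscillating : StrictMono oscillating := by
  refine strictMono_of_odd_strictMonoOn_nonneg oscillating_neg fun x hx y _ hxy => ?_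
  rcases (Set.mem_Ici.1 hx).eq_or_lt with rfl | hx
  · simpa [oscillating] using oscillating_pos hxy
  have hy : 0 < y := hx.trans hxy
  have hlog : Real.log y - Real.log x ≤ y / x - 1 := by
    rw [← Real.log_div hy.ne' hx.ne']
    exact Real.log_le_sub_one_of_pos (by positivity)
  have hsin : |Real.sin (Real.log x) - Real.sin (Real.log y)| ≤ |Real.log x - Real.log y| :=
    Real.abs_sin_sub_sin_le _ _
  rw [abs_sub_comm (Real.log x), abs_of_pos (sub_pos.2 (Real.log_lt_log hx hxy))] at hsin
  have hdiff : x * (Real.sin (Real.log x) - Real.sin (Real.log y)) ≤ y - x := by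
    calc x * (Real.sin (Real.log x) - Real.sin (Real.log y)) ≤ x * (y / x - 1) := by
          exact mul_le_mul_of_nonneg_left ((le_abs_self _).trans (hsin.trans hlog)) hx.le
      _ = y - x := by field_simp
  unfold oscillating
  nlinarith [Real.neg_one_le_sin (Real.log y)]

/-- The increasing function whose root determines the solution of the system. -/
lemma strictMono_oscillating_add {lam : ℝ} (hlam : 0 < lam) :
    StrictMono fun x => oscillating x + (1 + lam) * x :=
  strictMono_oscillating.add fun x y hxy => by gcongr

lemma resolvent_eq {lam u v : ℝ} (hu : lam * u + -oscillating (1 - (u - v)) = 0)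
    (hv : lam * v + (1 + (v - u)) = 0) :
    oscillating (1 - (u - v)) + (1 + lam) * (1 - (u - v)) = lam := by
  linarith

lemma solution_unique {lam u v u' v' : ℝ} (hlam : 0 < lam)
    (hu : lam * u + -oscillating (1 - (u - v)) = 0) (hv : lam * v + (1 + (v - u)) = 0)
    (hu' : lam * u' + -oscillating (1 - (u' - v')) = 0)
    (hv' : lam * v' + (1 + (v' - u')) = 0) : u = u' ∧ v = v' := by
  have h := (strictMono_oscillating_add hlam).injective
    ((resolvent_eq hu hv).trans (resolvent_eq hu' hv').symm)
  have hvv : v = v' := mul_left_cancel₀ hlam.ne' (by linarith)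
  exact ⟨by linarith, hvv⟩

lemma solution_exists {lam : ℝ} (hlam : 0 < lam) :
    ∃ u v : ℝ, lam * u + -oscillating (1 - (u - v)) = 0 ∧ lam * v + (1 + (v - u)) = 0 := by
  have hc : Continuous fun x => oscillating x + (1 + lam) * x :=
    continuous_oscillating.add (by fun_prop)
  obtain ⟨x, -, hx⟩ := intermediate_value_Icc (zero_le_one (α := ℝ)) hc.continuousOn
    (show lam ∈ _ from ⟨by simpa [oscillating] using hlam.le,
      by linarith [oscillating_pos one_pos]⟩)
  dsimp only at hx
  have hsub : oscillating x / lam - -x / lam = 1 - x := by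
    field_simp
    linarith
  refine ⟨oscillating x / lam, -x / lam, ?_, ?_⟩
  · rw [hsub, sub_sub_cancel]
    field_simp
    ring
  · rw [← neg_sub (oscillating x / lam), hsub]
    field_simp
    ring

lemma solution_bounded {lam u v : ℝ} (hlam : 0 < lam)
    (hu : lam * u + -oscillating (1 - (u - v)) = 0) (hv : lam * v + (1 + (v - u)) = 0) :
    |u| ≤ 1 ∧ |v| ≤ 1 := by
  have hx : 0 < 1 - (u - v) := by
    refine (strictMono_oscillating_add hlam).lt_iff_lt.1 ?_
    rw [resolvent_eq hu hv]
    simpa [oscillating] using hlam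
  have hu0 : 0 < u := pos_of_mul_pos_right (by linarith [oscillating_pos hx]) hlam.le
  have hv0 : 0 < -v := pos_of_mul_pos_right (a := lam) (by linarith) hlam.le
  constructor <;> rw [abs_le] <;> constructor <;> linarith

/-- Along parameters where `sin (log x)` is constant, the second coordinate of the solutions
converges, with a limit depending on that constant. -/
lemma limit_snd_eq {s : ℝ → ℝ × ℝ}
    (hs : ∀ lam : ℝ, 0 < lam →
      lam * (s lam).1 + -oscillating (1 - ((s lam).1 - (s lam).2)) = 0 ∧
      lam * (s lam).2 + (1 + ((s lam).2 - (s lam).1)) = 0)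
    {p : ℝ × ℝ} (hp : Tendsto s (𝓝[>] 0) (𝓝 p)) (a : ℝ) :
    p.2 = -1 / (4 + Real.sin a) := by
  have hc : 0 < 4 + Real.sin a := by linarith [Real.neg_one_le_sin a]
  set x : ℕ → ℝ := fun n => Real.exp (a - n * (2 * Real.pi)) with hxdef
  have hxpos (n : ℕ) : 0 < x n := Real.exp_pos _
  have hosc (n : ℕ) : oscillating (x n) = x n * (3 + Real.sin a) := by
    simp only [oscillating, hxdef, Real.log_exp, Real.sin_sub_nat_mul_two_pi]
  have hx0 : Tendsto x atTop (𝓝 0) := by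
    refine Real.tendsto_exp_atBot.comp ?_
    simp only [sub_eq_add_neg]
    exact tendsto_atBot_add_const_left _ _ (tendsto_neg_atTop_atBot.comp
      (tendsto_natCast_atTop_atTop.atTop_mul_const Real.two_pi_pos))
  have hx1 : ∀ᶠ n in atTop, x n < 1 := hx0.eventually (gt_mem_nhds one_pos)
  set l : ℕ → ℝ := fun n => x n * (4 + Real.sin a) / (1 - x n) with hldef
  have hlpos : ∀ᶠ n in atTop, 0 < l n := by
    filter_upwards [hx1] with n hn
    exact div_pos (mul_pos (hxpos n) hc) (sub_pos.2 hn)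
  have hl0 : Tendsto l atTop (𝓝 0) := by
    have h := (hx0.mul_const (4 + Real.sin a)).div (tendsto_const_nhds.sub hx0)
      (by norm_num : (1 : ℝ) - 0 ≠ 0)
    rwa [zero_mul, zero_div] at h
  have hlim : Tendsto (fun n => (s (l n)).2) atTop (𝓝 p.2) :=
    (continuous_snd.tendsto p).comp (hp.comp (tendsto_nhdsWithin_iff.2 ⟨hl0, hlpos⟩))
  have hlim' : Tendsto (fun n => -(1 - x n) / (4 + Real.sin a)) atTop
      (𝓝 (-1 / (4 + Real.sin a))) := by
    simpa using ((tendsto_const_nhds (x := (1 : ℝ))).sub hx0).neg.div_const (4 + Real.sin a)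
  refine tendsto_nhds_unique hlim (hlim'.congr' ?_)
  filter_upwards [hx1, hlpos] with n hn hln
  have hne : 1 - x n ≠ 0 := (sub_pos.2 hn).ne'
  have hsub : (1 - x n) * (3 + Real.sin a) / (4 + Real.sin a) -
      -(1 - x n) / (4 + Real.sin a) = 1 - x n := by
    field_simp
    ring
  refine (solution_unique (u := (1 - x n) * (3 + Real.sin a) / (4 + Real.sin a)) hln
    ?_ ?_ (hs _ hln).1 (hs _ hln).2).2
  · rw [hsub, sub_sub_cancel, hosc]
    simp only [hldef]
    field_simp
    ring
  · rw [← neg_sub ((1 - x n) * (3 + Real.sin a) / (4 + Real.sin a)), hsub]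
    simp only [hldef]
    field_simp
    ring

/-- Theorem 1: there exist continuous strictly increasing f, g : ℝ → ℝ
such that (a) for every λ > 0 the system λu + f(u−v) = 0, λv + g(v−u) = 0 has a unique
solution (u_λ, v_λ); (b) the family of solutions is bounded; (c) no selection of
solutions converges as λ → 0+. -/
theorem stmt_18 :
    ∃ f g : ℝ → ℝ, Continuous f ∧ StrictMono f ∧ Continuous g ∧ StrictMono g ∧
      (∀ lam : ℝ, 0 < lam →
        ∃! p : ℝ × ℝ, lam * p.1 + f (p.1 - p.2) = 0 ∧ lam * p.2 + g (p.2 - p.1) = 0) ∧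
      (∃ C : ℝ, ∀ lam : ℝ, 0 < lam → ∀ u v : ℝ,
        lam * u + f (u - v) = 0 → lam * v + g (v - u) = 0 → |u| ≤ C ∧ |v| ≤ C) ∧
      (∀ s : ℝ → ℝ × ℝ,
        (∀ lam : ℝ, 0 < lam →
          lam * (s lam).1 + f ((s lam).1 - (s lam).2) = 0 ∧
          lam * (s lam).2 + g ((s lam).2 - (s lam).1) = 0) →
        ¬ ∃ p : ℝ × ℝ, Filter.Tendsto s (nhdsWithin 0 (Set.Ioi 0)) (nhds p)) := by
  refine ⟨fun w => -oscillating (1 - w), fun z => 1 + z,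
    (continuous_oscillating.comp (by fun_prop)).neg,
    fun w z h => neg_lt_neg (strictMono_oscillating (by linarith)),
    by fun_prop, fun w z h => by dsimp only; linarith, fun lam hlam => ?_,
    ⟨1, fun lam hlam u v hu hv => solution_bounded hlam hu hv⟩, ?_⟩
  · obtain ⟨u, v, hu, hv⟩ := solution_exists hlam
    refine ⟨(u, v), ⟨hu, hv⟩, fun q hq => ?_⟩
    obtain ⟨h1, h2⟩ := solution_unique hlam hq.1 hq.2 hu hv
    exact Prod.ext h1 h2
  · rintro s hs ⟨p, hp⟩
    have h := (limit_snd_eq hs hp 0).symm.trans (limit_snd_eq hs hp (Real.pi / 2))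
    norm_num at h
end
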